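/- Let h ∈ (0,1), let σ be a behavior strategy in G_h, and let σ̂ be the mimicking strategy in G_1 defined by σ̂(η_k)(â) = P^h_σ(a'_{T_k} = â | H^fil_k = η_k) (with an arbitrary fixed mixed action when P^h_σ(H^fil_k = η_k) = 0). Then for every k ≥ 1, every history η_k of length k, every state ω ∈ Ω, and every action a ∈ A, the joint laws agree: P^1_{σ̂}(the history of the first k stages of G_1 equals η_k, ω_k = ω, a_k = a) = P^h_σ(H^fil_k = η_k, ω'_{T_k} = ω, a'_{T_k} = a). -/

import Mathlib

open Filter

/-- A POMDP (data only): deterministic signal map `f`, stage payoff `g`,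
transition kernel `P`, and initial distribution `p1`. -/
structure POMDP (Ω A S : Type*) where
  f : Ω → S
  g : Ω → A → ℝ
  P : Ω → A → Ω → ℝ
  p1 : Ω → ℝ

/-- A history `(s₁, a₁, …, a_{t-1}, s_t)`, encoded as the reversed list of past
(signal, action) pairs together with the current signal. -/
abbrev Hist (S A : Type*) := List (S × A) × S

/-- A behavior strategy (data only): a mixed action for every finite history. -/
abbrev Strategy (S A : Type*) := Hist S A → A → ℝ

/-- `σ η ∈ Δ(A)` for every history `η`. -/
def IsStrategy {S A : Type*} [Fintype A] (σ : Strategy S A) : Prop :=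
  (∀ η a, 0 ≤ σ η a) ∧ ∀ η, ∑ a, σ η a = 1

namespace POMDP

variable {Ω A S : Type*} [Fintype Ω] [Fintype A]

/-- `P ω a ∈ Δ(Ω)` for every `(ω, a)`, and `p1 ∈ Δ(Ω)`. -/
def IsValid (M : POMDP Ω A S) : Prop :=
  (∀ ω a ω', 0 ≤ M.P ω a ω') ∧ (∀ ω a, ∑ ω', M.P ω a ω' = 1) ∧
    (∀ ω, 0 ≤ M.p1 ω) ∧ ∑ ω, M.p1 ω = 1

/-- The observable history determined by a reversed past trajectory and the
current state. -/
def obs (M : POMDP Ω A S) (rev : List (Ω × A)) (ω : Ω) : Hist S A :=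
  (rev.map fun p => (M.f p.1, p.2), M.f ω)

/-- Probability of a finite trajectory `(ω₁, a₁, …, ω_t, a_t)` under a strategy,
the trajectory being given in reverse order (the head of the list is the most
recent (state, action) pair). -/
def trajP (M : POMDP Ω A S) (σ : Strategy S A) : List (Ω × A) → ℝ
  | [] => 1
  | (ω, a) :: rest =>
      (match rest with
        | [] => M.p1 ω
        | (ω', a') :: _ => M.P ω' a' ω) *
        σ (M.obs rest ω) a * trajP M σ rest

/-- The expected stage-`(n+1)` payoff `E_σ[g(ω_{n+1}, a_{n+1})]`. -/
noncomputable def stageE (M : POMDP Ω A S) (σ : Strategy S A) (n : ℕ) : ℝ :=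
  ∑ tr : Fin (n + 1) → Ω × A, trajP M σ (List.ofFn tr) * M.g (tr 0).1 (tr 0).2

/-- The expected long-run average payoff
`R(σ) = liminf_T E_σ[(1/T) ∑_{i=1}^T g(ω_i, a_i)]`. -/
noncomputable def R (M : POMDP Ω A S) (σ : Strategy S A) : ℝ :=
  liminf (fun T : ℕ => (1 / (T : ℝ)) * ∑ n ∈ Finset.range T, stageE M σ n) atTop

/-- The POMDP `G_h` with stage duration `h`:
`P_h(⬝|ω,a) = h·P(⬝|ω,a) + (1-h)·δ_ω`. -/
def dur [DecidableEq Ω] (M : POMDP Ω A S) (h : ℝ) : POMDP Ω A S :=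
  { M with P := fun ω a ω' => h * M.P ω a ω' + (1 - h) * (if ω' = ω then 1 else 0) }

/-- The asymptotic value `V(h) = sup_σ R(σ, h)` of `G_h`. -/
noncomputable def V [DecidableEq Ω] (M : POMDP Ω A S) (h : ℝ) : ℝ :=
  sSup {r | ∃ σ : Strategy S A, IsStrategy σ ∧ r = (M.dur h).R σ}

end POMDP

namespace POMDP

variable {Ω A S : Type*} [Fintype Ω] [Fintype A]

/-- Observable history determined by a reversed past extended trajectory
(with coin flips) and the current state. -/
def obsE (M : POMDP Ω A S) (rev : List (Ω × A × Bool)) (ω : Ω) : Hist S A :=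
  (rev.map fun p => (M.f p.1, p.2.1), M.f ω)

/-- Probability of a finite extended trajectory in `G_h` under `σ`, given in
reverse order: each stage records the state, the action, and the coin `X_i`
deciding whether the transition at the end of the stage is governed by `P`
(`true`, probability `h`) or the state is frozen (`false`, probability `1-h`). -/
def etrajP [DecidableEq Ω] (M : POMDP Ω A S) (h : ℝ) (σ : Strategy S A) :
    List (Ω × A × Bool) → ℝ
  | [] => 1
  | (ω, a, x) :: rest =>
      (match rest with
        | [] => M.p1 ω
        | (ω', a', x') :: _ =>
            if x' then M.P ω' a' ω else if ω = ω' then 1 else 0) *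
        σ (M.obsE rest ω) a * (if x then h else 1 - h) * etrajP M h σ rest

variable [DecidableEq Ω]

/-- Probability of a forward extended trajectory `tr` (stage 1 first). -/
noncomputable def eP (M : POMDP Ω A S) (h : ℝ) (σ : Strategy S A) {n : ℕ}
    (tr : Fin n → Ω × A × Bool) : ℝ :=
  etrajP M h σ (List.ofFn tr).reverse

/-- `E^h_σ[g(ω'_{T_k}, a'_{T_k})]`, decomposed over the value `n+1` of `T_k`:
`T_k = n+1` iff the last coin is `true` and there are exactly `k` `true` coins. -/
noncomputable def ETk (M : POMDP Ω A S) (h : ℝ) (σ : Strategy S A) (k : ℕ) : ℝ :=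
  ∑' n : ℕ, ∑ tr : Fin (n + 1) → Ω × A × Bool,
    if (tr (Fin.last n)).2.2 = true ∧ (List.ofFn tr).countP (fun p => p.2.2) = k then
      eP M h σ tr * M.g (tr (Fin.last n)).1 (tr (Fin.last n)).2.1
    else 0

end POMDP

namespace POMDP

variable {Ω A S : Type*} [Fintype Ω] [Fintype A]

/-- Auxiliary computation of the filtered history along a *forward* extended
trajectory: `acc` is the reversed list of (signal, action) pairs recorded so far
and `s` is the current pending signal. At a stage whose coin is `true` (and which
is not the last stage of the trajectory), the pair `(s, action)` is recorded and
the pending signal becomes the signal of the state of the next stage. -/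
def filAux (f : Ω → S) : List (S × A) → S → List (Ω × A × Bool) → Hist S A
  | acc, s, [] => (acc, s)
  | acc, s, (_, a, x) :: rest =>
      if x then
        match rest with
        | [] => (acc, s)
        | (ω', _, _) :: _ => filAux f ((s, a) :: acc) (f ω') rest
      else filAux f acc s rest

/-- The filtered history `H^fil_k = (s'_1, a'_{T_1}, s'_{T_1+1}, …, a'_{T_{k-1}},
s'_{T_{k-1}+1})` of a forward extended trajectory whose length is `T_k`. -/
def filHist (M : POMDP Ω A S) {n : ℕ} (tr : Fin (n + 1) → Ω × A × Bool) : Hist S A :=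
  filAux M.f [] (M.f (tr 0).1) (List.ofFn tr)

variable [DecidableEq Ω] [DecidableEq A] [DecidableEq S]

/-- `P^h_σ(H^fil_k = η, ω'_{T_k} = ω, a'_{T_k} = a)`, decomposed over the value
`n+1` of `T_k` (the event entails `T_k < ∞`). -/
noncomputable def jointFil (M : POMDP Ω A S) (h : ℝ) (σ : Strategy S A) (k : ℕ)
    (η : Hist S A) (ω : Ω) (a : A) : ℝ :=
  ∑' n : ℕ, ∑ tr : Fin (n + 1) → Ω × A × Bool,
    if (tr (Fin.last n)).2.2 = true ∧ (List.ofFn tr).countP (fun p => p.2.2) = k ∧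
        filHist M tr = η ∧ (tr (Fin.last n)).1 = ω ∧ (tr (Fin.last n)).2.1 = a then
      eP M h σ tr
    else 0

/-- `P^h_σ(H^fil_k = η, a'_{T_k} = a)`. -/
noncomputable def jointFilA (M : POMDP Ω A S) (h : ℝ) (σ : Strategy S A) (k : ℕ)
    (η : Hist S A) (a : A) : ℝ :=
  ∑ ω : Ω, jointFil M h σ k η ω a

/-- `P^h_σ(H^fil_k = η)` (the event `T_k = ∞` being null). -/
noncomputable def probFil (M : POMDP Ω A S) (h : ℝ) (σ : Strategy S A) (k : ℕ)
    (η : Hist S A) : ℝ :=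
  ∑ a : A, jointFilA M h σ k η a

/-- The mimicking strategy `σ̂` in `G₁`: at a history `η` of length `k`
(`k = η.1.length + 1`), it plays the conditional law of `a'_{T_k}` given
`H^fil_k = η`; if the conditioning event is null it plays the fixed mixed
action `ρ`. -/
noncomputable def mimic (M : POMDP Ω A S) (h : ℝ) (σ : Strategy S A) (ρ : A → ℝ) :
    Strategy S A := fun η a =>
  if probFil M h σ (η.1.length + 1) η = 0 then ρ a
  else jointFilA M h σ (η.1.length + 1) η a / probFil M h σ (η.1.length + 1) η

end POMDP

namespace POMDP

variable {Ω A S : Type*} [Fintype Ω] [Fintype A]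

/-- `P^1_{σ'}`(the observable history of the first `n+1` stages is `η`,
`ω_{n+1} = ω`, `a_{n+1} = a`) in the base POMDP `G₁`; trajectories are given as
reversed functions (`tr 0` is the last stage). -/
noncomputable def jointBase [DecidableEq Ω] [DecidableEq A] [DecidableEq S]
    (M : POMDP Ω A S) (σ' : Strategy S A) (n : ℕ)
    (η : Hist S A) (ω : Ω) (a : A) : ℝ :=
  ∑ tr : Fin (n + 1) → Ω × A,
    if M.obs (List.ofFn tr).tail (tr 0).1 = η ∧ (tr 0).1 = ω ∧ (tr 0).2 = a then
      trajP M σ' (List.ofFn tr)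
    else 0

end POMDP

namespace POMDP

section SumLemmas

theorem sum_fin_cons {X : Type*} [Fintype X] {n : ℕ} (F : (Fin (n + 1) → X) → ℝ) :
    ∑ tr, F tr = ∑ x, ∑ e : Fin n → X, F (Fin.cons x e) := by
  rw [← Fintype.sum_prod_type']
  exact (Fintype.sum_equiv (Fin.consEquiv fun _ => X) _ _ fun _ => rfl).symm

theorem sum_fin_rev {X : Type*} [Fintype X] {n : ℕ} (F : (Fin n → X) → ℝ) :
    ∑ tr, F tr = ∑ tr : Fin n → X, F (fun i => tr i.rev) :=
  (Fintype.sum_equiv (Fin.revPerm.arrowCongr (Equiv.refl X)) _ _ fun _ => rfl).symm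

theorem ofFn_comp_rev {X : Type*} {n : ℕ} (tr : Fin n → X) :
    List.ofFn (fun i => tr i.rev) = (List.ofFn tr).reverse := by
  apply List.ext_getElem
  · simp
  · intro i h₁ h₂
    simp only [List.getElem_ofFn, List.getElem_reverse, List.length_ofFn]
    congr 1
    ext
    simp only [Fin.val_rev]
    omega

/-- A sequence with `u (n + 1) = (1 - h) * u n + v n` and `v` summable is summable, and
`h * ∑ u = u 0 + ∑ v`. -/
theorem summable_of_affine_rec {h : ℝ} (hh : h ∈ Set.Ioo (0 : ℝ) 1) {u v : ℕ → ℝ}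
    (hu : ∀ n, 0 ≤ u n) (hv : ∀ n, 0 ≤ v n) (hvs : Summable v)
    (hrec : ∀ n, u (n + 1) = (1 - h) * u n + v n) :
    Summable u ∧ ∑' n, h * u n = u 0 + ∑' n, v n := by
  have hh0 : 0 < h := hh.1
  have hh1 : h < 1 := hh.2
  have hs : Summable u := by
    refine summable_of_sum_range_le (c := (u 0 + ∑' n, v n) / h) hu fun N => ?_
    rw [le_div_iff₀ hh0]
    have h1 : ∑ n ∈ Finset.range N, u n ≤ ∑ n ∈ Finset.range (N + 1), u n := by
      rw [Finset.sum_range_succ]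
      linarith [hu N]
    have h2 : ∑ n ∈ Finset.range (N + 1), u n
        = (1 - h) * ∑ n ∈ Finset.range N, u n + ∑ n ∈ Finset.range N, v n + u 0 := by
      rw [Finset.sum_range_succ', Finset.mul_sum, ← Finset.sum_add_distrib]
      simp only [hrec]
    have h3 : ∑ n ∈ Finset.range N, v n ≤ ∑' n, v n :=
      hvs.sum_le_tsum _ fun n _ => hv n
    linarith
  refine ⟨hs, ?_⟩
  have h1 : ∑' n, u n = u 0 + ∑' n, u (n + 1) := hs.tsum_eq_zero_add
  simp only [hrec] at h1
  rw [(hs.mul_left (1 - h)).tsum_add hvs, tsum_mul_left] at h1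
  rw [tsum_mul_left]
  linarith

end SumLemmas

section FilteredHistory

variable {Ω A S : Type*}

/-- The filtered history by recursion on the reversed past and the current state. -/
def filRev (f : Ω → S) : List (Ω × A × Bool) → Ω → Hist S A
  | [], ω => ([], f ω)
  | (ω', a', x') :: e, ω =>
      if x' then (((filRev f e ω').2, a') :: (filRev f e ω').1, f ω) else filRev f e ω'

theorem filAux_append_singleton (f : Ω → S) (l : List (Ω × A × Bool)) :
    ∀ (acc : List (S × A)) (s : S) (y z : Ω × A × Bool),
      filAux f acc s (l ++ [y, z]) =
        if y.2.2 then
          (((filAux f acc s (l ++ [y])).2, y.2.1) :: (filAux f acc s (l ++ [y])).1, f z.1)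
        else filAux f acc s (l ++ [y]) := by
  induction l with
  | nil =>
    rintro acc s ⟨ω, a, x⟩ ⟨ω', a', x'⟩
    cases x <;> cases x' <;> simp [filAux]
  | cons p l ih =>
    rintro acc s y z
    obtain ⟨ω, a, x⟩ := p
    cases l with
    | nil => cases x <;> simp [filAux]
    | cons q l => cases x <;> simpa [filAux] using ih _ _ y z

theorem filAux_reverse_cons (f : Ω → S) (e : List (Ω × A × Bool)) :
    ∀ (x : Ω × A × Bool),
      filAux f [] (f ((x :: e).getLast (List.cons_ne_nil x e)).1) (x :: e).reverse
        = filRev f e x.1 := by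
  induction e with
  | nil =>
    rintro ⟨ω, a, x⟩
    cases x <;> simp [filAux, filRev]
  | cons y e ih =>
    rintro x
    have h1 : (x :: y :: e).reverse = e.reverse ++ [y, x] := by simp
    have h2 := ih y
    rw [List.reverse_cons] at h2
    rw [h1, filAux_append_singleton, List.getLast_cons (List.cons_ne_nil y e), h2]
    rfl

theorem length_filRev (f : Ω → S) (e : List (Ω × A × Bool)) :
    ∀ ω, (filRev f e ω).1.length = e.countP (fun p => p.2.2) := by
  induction e with
  | nil => intro ω; rfl
  | cons y e ih =>
    obtain ⟨ω', a', x'⟩ := y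
    intro ω
    cases x' <;> simp [filRev, ih]

theorem filHist_rev (M : POMDP Ω A S) {n : ℕ} (x : Ω × A × Bool) (e : Fin n → Ω × A × Bool) :
    filHist M (fun i => (Fin.cons x e : Fin (n + 1) → Ω × A × Bool) i.rev)
      = filRev M.f (List.ofFn e) x.1 := by
  rw [← filAux_reverse_cons, filHist, ofFn_comp_rev]
  have h1 : (List.ofFn (Fin.cons x e : Fin (n + 1) → Ω × A × Bool)) = x :: List.ofFn e := by
    simp [List.ofFn_succ]
  simp only [← h1]
  rw [List.getLast_ofFn]
  rfl

end FilteredHistory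

variable {Ω A S : Type*}

/-- Probability that the reversed trajectory `e` occurs and is followed by the state `ω`. -/
def arrive (M : POMDP Ω A S) (σ : Strategy S A) : List (Ω × A) → Ω → ℝ
  | [], ω => M.p1 ω
  | (ω', a') :: e, ω => M.P ω' a' ω * σ (M.obs e ω') a' * arrive M σ e ω'

theorem trajP_cons (M : POMDP Ω A S) (σ : Strategy S A) (e : List (Ω × A)) :
    ∀ ω a, trajP M σ ((ω, a) :: e) = arrive M σ e ω * σ (M.obs e ω) a := by
  induction e with
  | nil => intro ω a; simp [trajP, arrive]
  | cons y e ih =>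
    obtain ⟨ω', a'⟩ := y
    intro ω a
    rw [trajP, ih, arrive]
    ring

/-- Probability that the reversed extended trajectory `e` occurs and is followed by the
state `ω`. -/
def arriveE [DecidableEq Ω] (M : POMDP Ω A S) (h : ℝ) (σ : Strategy S A) :
    List (Ω × A × Bool) → Ω → ℝ
  | [], ω => M.p1 ω
  | (ω', a', x') :: e, ω =>
      (if x' then M.P ω' a' ω else if ω = ω' then 1 else 0) * σ (M.obsE e ω') a' *
        (if x' then h else 1 - h) * arriveE M h σ e ω'

theorem etrajP_cons [DecidableEq Ω] (M : POMDP Ω A S) (h : ℝ) (σ : Strategy S A)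
    (e : List (Ω × A × Bool)) :
    ∀ ω a x, etrajP M h σ ((ω, a, x) :: e)
      = arriveE M h σ e ω * σ (M.obsE e ω) a * (if x then h else 1 - h) := by
  induction e with
  | nil => intro ω a x; simp [etrajP, arriveE]
  | cons y e ih =>
    obtain ⟨ω', a', x'⟩ := y
    intro ω a x
    rw [etrajP, ih, arriveE]
    ring

section Environment

variable [Fintype Ω]

/-- Environment part of the law of a history: the sum, over the state sequences ending in `ω`
with the signals of the history, of the initial and transition probabilities. -/
def env [DecidableEq S] (M : POMDP Ω A S) : List (S × A) → S → Ω → ℝ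
  | [], s, ω => if M.f ω = s then M.p1 ω else 0
  | (s', a') :: acc, s, ω =>
      if M.f ω = s then ∑ ω', M.P ω' a' ω * env M acc s' ω' else 0

theorem env_nonneg [DecidableEq S] {M : POMDP Ω A S} (hM : M.IsValid) (l : List (S × A)) :
    ∀ s ω, 0 ≤ env M l s ω := by
  induction l with
  | nil =>
    intro s ω
    rw [env]
    split_ifs
    exacts [hM.2.2.1 ω, le_rfl]
  | cons p l ih =>
    intro s ω
    rw [env]
    split_ifs
    exacts [Finset.sum_nonneg fun ω' _ => mul_nonneg (hM.1 _ _ _) (ih _ _), le_rfl]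

theorem env_eq_zero [DecidableEq S] (M : POMDP Ω A S) (l : List (S × A)) {s : S} {ω : Ω}
    (hs : M.f ω ≠ s) : env M l s ω = 0 := by
  cases l <;> simp [env, hs]

end Environment

variable [Fintype Ω] [Fintype A]

/-- Control part of the law of the filtered history: the expectation of `φ` (a function of the
full observed history) over the actions and coins of the first `n` stages, restricted to those
producing the filtered history `η`. -/
def ctrl (h : ℝ) (σ : Strategy S A) : ℕ → Hist S A → (Hist S A → ℝ) → ℝ
  | 0, ([], s), φ => φ ([], s)
  | 0, (_ :: _, _), _ => 0
  | n + 1, ([], s), φ =>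
      (1 - h) * ∑ a, ctrl h σ n ([], s) fun H => σ H a * φ ((H.2, a) :: H.1, s)
  | n + 1, ((s', a') :: acc, s), φ =>
      (1 - h) * ∑ a, ctrl h σ n ((s', a') :: acc, s)
          (fun H => σ H a * φ ((H.2, a) :: H.1, s)) +
        h * ctrl h σ n (acc, s') fun H => σ H a' * φ ((H.2, a') :: H.1, s)

section Ctrl

variable {h : ℝ} {σ : Strategy S A}

theorem ctrl_const_mul (c : ℝ) (n : ℕ) : ∀ (η : Hist S A) (φ : Hist S A → ℝ),
    ctrl h σ n η (fun H => c * φ H) = c * ctrl h σ n η φ := by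
  induction n with
  | zero => rintro ⟨_ | ⟨_, _⟩, s⟩ φ <;> simp [ctrl]
  | succ n ih =>
    rintro ⟨_ | ⟨⟨s', a'⟩, acc⟩, s⟩ φ <;>
      simp only [ctrl, mul_left_comm _ c, ih, ← Finset.mul_sum, mul_add]

theorem ctrl_sum {ι : Type*} (t : Finset ι) (n : ℕ) : ∀ (η : Hist S A) (φ : ι → Hist S A → ℝ),
    ctrl h σ n η (fun H => ∑ i ∈ t, φ i H) = ∑ i ∈ t, ctrl h σ n η (φ i) := by
  induction n with
  | zero => rintro ⟨_ | ⟨_, _⟩, s⟩ φ <;> simp [ctrl]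
  | succ n ih =>
    rintro ⟨_ | ⟨⟨s', a'⟩, acc⟩, s⟩ φ <;>
      simp only [ctrl, Finset.mul_sum, ih, Finset.sum_add_distrib] <;> rw [Finset.sum_comm]

theorem ctrl_mono (hh : h ∈ Set.Ioo (0 : ℝ) 1) (hσ : IsStrategy σ) (n : ℕ) :
    ∀ (η : Hist S A) (φ ψ : Hist S A → ℝ), (∀ H, φ H ≤ ψ H) →
      ctrl h σ n η φ ≤ ctrl h σ n η ψ := by
  have hh0 : 0 ≤ h := hh.1.le
  have hh1 : 0 ≤ 1 - h := sub_nonneg.2 hh.2.le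
  induction n with
  | zero =>
    rintro ⟨_ | ⟨_, _⟩, s⟩ φ ψ hφ
    exacts [hφ _, le_rfl]
  | succ n ih =>
    have key : ∀ (η : Hist S A) (s : S) (a : A) (φ ψ : Hist S A → ℝ), (∀ H, φ H ≤ ψ H) →
        ctrl h σ n η (fun H => σ H a * φ ((H.2, a) :: H.1, s))
          ≤ ctrl h σ n η (fun H => σ H a * ψ ((H.2, a) :: H.1, s)) :=
      fun η s a φ ψ hφ => ih _ _ _ fun H => mul_le_mul_of_nonneg_left (hφ _) (hσ.1 _ _)
    rintro ⟨_ | ⟨⟨s', a'⟩, acc⟩, s⟩ φ ψ hφ <;> simp only [ctrl]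
    · exact mul_le_mul_of_nonneg_left (Finset.sum_le_sum fun a _ => key _ _ _ _ _ hφ) hh1
    · exact add_le_add
        (mul_le_mul_of_nonneg_left (Finset.sum_le_sum fun a _ => key _ _ _ _ _ hφ) hh1)
        (mul_le_mul_of_nonneg_left (key _ _ _ _ _ hφ) hh0)

theorem ctrl_nonneg (hh : h ∈ Set.Ioo (0 : ℝ) 1) (hσ : IsStrategy σ) (n : ℕ) (η : Hist S A)
    (φ : Hist S A → ℝ) (hφ : ∀ H, 0 ≤ φ H) : 0 ≤ ctrl h σ n η φ := by
  have h0 := ctrl_const_mul (h := h) (σ := σ) 0 n η φ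
  simp only [zero_mul] at h0
  rw [← h0]
  exact ctrl_mono hh hσ n η _ _ hφ

theorem sum_ctrl_strategy (hσ : IsStrategy σ) (n : ℕ) (η : Hist S A) :
    ∑ a, ctrl h σ n η (fun H => σ H a) = ctrl h σ n η fun _ => 1 := by
  rw [← ctrl_sum]
  simp only [hσ.2]

/-- Control part of the probability that the filtered history is `η` and is followed by the
action `a`. -/
noncomputable def ctrlAct (h : ℝ) (σ : Strategy S A) (η : Hist S A) (a : A) : ℝ :=
  ∑' n, h * ctrl h σ n η fun H => σ H a

/-- Control part of the probability that the filtered history is `η`. -/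
noncomputable def ctrlHist (h : ℝ) (σ : Strategy S A) (η : Hist S A) : ℝ :=
  ∑' n, h * ctrl h σ n η fun _ => 1

theorem ctrl_act_nonneg (hh : h ∈ Set.Ioo (0 : ℝ) 1) (hσ : IsStrategy σ) (η : Hist S A) (a : A)
    (n : ℕ) : 0 ≤ h * ctrl h σ n η fun H => σ H a :=
  mul_nonneg hh.1.le (ctrl_nonneg hh hσ _ _ _ fun H => hσ.1 H a)

theorem summable_ctrl_act (hh : h ∈ Set.Ioo (0 : ℝ) 1) (hσ : IsStrategy σ) (η : Hist S A)
    (hs : Summable fun n => ctrl h σ n η fun _ => 1) (a : A) :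
    Summable fun n => h * ctrl h σ n η fun H => σ H a := by
  refine .of_nonneg_of_le (ctrl_act_nonneg hh hσ η a) (fun n => ?_) (hs.mul_left h)
  refine mul_le_mul_of_nonneg_left (ctrl_mono hh hσ _ _ _ _ fun H => ?_) hh.1.le
  rw [← hσ.2 H]
  exact Finset.single_le_sum (fun b _ => hσ.1 H b) (Finset.mem_univ a)

theorem summable_ctrl_nil (hh : h ∈ Set.Ioo (0 : ℝ) 1) (hσ : IsStrategy σ) (s : S) :
    (Summable fun n => ctrl h σ n ([], s) fun _ => 1) ∧ ctrlHist h σ ([], s) = 1 := by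
  have := summable_of_affine_rec hh (u := fun n => ctrl h σ n ([], s) fun _ => 1)
    (v := fun _ => 0) (fun n => ctrl_nonneg hh hσ _ _ _ fun _ => zero_le_one)
    (fun _ => le_rfl) summable_zero fun n => by
      simp only [ctrl, mul_one, sum_ctrl_strategy hσ, add_zero]
  simpa [ctrl, ctrlHist] using this

theorem summable_ctrl_cons (hh : h ∈ Set.Ioo (0 : ℝ) 1) (hσ : IsStrategy σ)
    (s' : S) (a' : A) (acc : List (S × A)) (s : S)
    (hs : Summable fun n => ctrl h σ n (acc, s') fun _ => 1) :
    (Summable fun n => ctrl h σ n ((s', a') :: acc, s) fun _ => 1) ∧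
      ctrlHist h σ ((s', a') :: acc, s) = ctrlAct h σ (acc, s') a' := by
  have := summable_of_affine_rec hh (u := fun n => ctrl h σ n ((s', a') :: acc, s) fun _ => 1)
    (v := fun n => h * ctrl h σ n (acc, s') fun H => σ H a')
    (fun n => ctrl_nonneg hh hσ _ _ _ fun _ => zero_le_one)
    (ctrl_act_nonneg hh hσ _ _) (summable_ctrl_act hh hσ _ hs a') fun n => by
      simp only [ctrl, mul_one, sum_ctrl_strategy hσ]
  simpa [ctrl, ctrlHist, ctrlAct] using this

theorem summable_ctrl (hh : h ∈ Set.Ioo (0 : ℝ) 1) (hσ : IsStrategy σ) (l : List (S × A)) :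
    ∀ s, Summable fun n => ctrl h σ n (l, s) fun _ => 1 := by
  induction l with
  | nil => exact fun s => (summable_ctrl_nil hh hσ s).1
  | cons p l ih => exact fun s => (summable_ctrl_cons hh hσ p.1 p.2 l s (ih p.1)).1

theorem ctrlAct_nonneg (hh : h ∈ Set.Ioo (0 : ℝ) 1) (hσ : IsStrategy σ) (η : Hist S A) (a : A) :
    0 ≤ ctrlAct h σ η a :=
  tsum_nonneg (ctrl_act_nonneg hh hσ η a)

theorem sum_ctrlAct (hh : h ∈ Set.Ioo (0 : ℝ) 1) (hσ : IsStrategy σ) (η : Hist S A) :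
    ∑ a, ctrlAct h σ η a = ctrlHist h σ η := by
  simp only [ctrlAct, ctrlHist]
  rw [← Summable.tsum_finsetSum fun a _ =>
    summable_ctrl_act hh hσ η (summable_ctrl hh hσ η.1 η.2) a]
  simp only [← Finset.mul_sum, sum_ctrl_strategy hσ]

end Ctrl

section Base

variable [DecidableEq A] [DecidableEq S]

theorem sum_arrive (M : POMDP Ω A S) (σ : Strategy S A) (prodσ : List (S × A) → S → ℝ)
    (hnil : ∀ s, prodσ [] s = 1)
    (hcons : ∀ s' a' l s, prodσ ((s', a') :: l) s = σ (l, s') a' * prodσ l s')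
    (l : List (S × A)) : ∀ (s : S) (ω : Ω),
      (∑ e : Fin l.length → Ω × A,
        if M.obs (List.ofFn e) ω = (l, s) then arrive M σ (List.ofFn e) ω else 0)
        = env M l s ω * prodσ l s := by
  induction l with
  | nil =>
    intro s ω
    by_cases hs : M.f ω = s <;> simp [obs, arrive, env, hnil, hs]
  | cons p l ih =>
    obtain ⟨s', a'⟩ := p
    intro s ω
    simp only [List.length_cons]
    rw [sum_fin_cons]
    by_cases hs : M.f ω = s
    · simp only [env, hs, if_true, Finset.sum_mul, Fintype.sum_prod_type, List.ofFn_cons]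
      refine Finset.sum_congr rfl fun ω' _ => ?_
      rw [Finset.sum_eq_single a']
      · rw [hcons, show ∀ p e c d : ℝ, p * e * (c * d) = p * c * (e * d) by intros; ring, ← ih,
          Finset.mul_sum]
        refine Finset.sum_congr rfl fun e _ => ?_
        have h2 : M.obs ((ω', a') :: List.ofFn e) ω = ((s', a') :: l, s) ↔
            M.obs (List.ofFn e) ω' = (l, s') := by
          simp [obs, hs, and_comm]
        simp only [h2]
        split_ifs with h3
        · rw [arrive, h3]
        · simp
      · intro a _ hne
        simp [obs, hne]
      · simp
    · simp [env, obs, hs]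

end Base

variable [DecidableEq Ω] [DecidableEq A] [DecidableEq S]

/-- The law of the filtered history factors into an environment and a control part. -/
theorem sum_arriveE (M : POMDP Ω A S) (h : ℝ) (σ : Strategy S A) (n : ℕ) :
    ∀ (η : Hist S A) (ω : Ω) (φ : Hist S A → ℝ),
      (∑ e : Fin n → Ω × A × Bool,
        if filRev M.f (List.ofFn e) ω = η then
          arriveE M h σ (List.ofFn e) ω * φ (M.obsE (List.ofFn e) ω) else 0)
        = env M η.1 η.2 ω * ctrl h σ n η φ := by
  induction n with
  | zero =>
    rintro ⟨_ | ⟨p, acc⟩, s⟩ ω φ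
    · by_cases hs : M.f ω = s
      · simp [filRev, arriveE, env, ctrl, obsE, hs]
      · simp [filRev, env, hs]
    · simp [filRev, ctrl]
  | succ n ih =>
    intro η ω φ
    have frozen : (∑ ω', ∑ a', ∑ e : Fin n → Ω × A × Bool,
        if filRev M.f (List.ofFn e) ω' = η then
          (if ω = ω' then 1 else 0) * σ (M.obsE (List.ofFn e) ω') a' * (1 - h) *
            arriveE M h σ (List.ofFn e) ω' *
            φ ((M.f ω', a') :: (M.obsE (List.ofFn e) ω').1, M.f ω) else 0)
        = env M η.1 η.2 ω * ((1 - h) * ∑ a, ctrl h σ n η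
          (fun H => σ H a * φ ((H.2, a) :: H.1, η.2))) := by
      rw [Finset.sum_eq_single ω]
      · by_cases hs : M.f ω = η.2
        · simp only [Finset.mul_sum, mul_left_comm _ (1 - h), ← ih]
          refine Finset.sum_congr rfl fun a _ => Finset.sum_congr rfl fun e _ => ?_
          split_ifs
          · rw [← hs]
            simp only [obsE]
            ring
          · simp
        · have h0 := fun φ => ih η ω φ
          simp only [env_eq_zero M _ hs, zero_mul] at h0 ⊢
          refine Finset.sum_eq_zero fun a _ => ?_
          refine Eq.trans ?_ (h0 fun H => σ H a * (1 - h) * φ ((M.f ω, a) :: H.1, M.f ω))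
          refine Finset.sum_congr rfl fun e _ => ?_
          split_ifs
          · ring
          · rfl
      · intro ω' _ hne
        simp [hne.symm]
      · simp
    have active : (∑ ω', ∑ a', ∑ e : Fin n → Ω × A × Bool,
        if (((filRev M.f (List.ofFn e) ω').2, a') :: (filRev M.f (List.ofFn e) ω').1, M.f ω) = η
          then
          M.P ω' a' ω * σ (M.obsE (List.ofFn e) ω') a' * h *
            arriveE M h σ (List.ofFn e) ω' *
            φ ((M.f ω', a') :: (M.obsE (List.ofFn e) ω').1, M.f ω) else 0)
        = match η with
          | ([], _) => 0
          | ((s', a') :: acc, s) => env M ((s', a') :: acc) s ω *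
              (h * ctrl h σ n (acc, s') fun H => σ H a' * φ ((H.2, a') :: H.1, s)) := by
      obtain ⟨_ | ⟨⟨s', a'⟩, acc⟩, s⟩ := η
      · simp
      · by_cases hs : M.f ω = s
        · simp only [env, hs, if_true, Finset.sum_mul]
          refine Finset.sum_congr rfl fun ω' _ => ?_
          rw [Finset.sum_eq_single a']
          · have h1 := ih (acc, s') ω' fun H => σ H a' * φ ((H.2, a') :: H.1, s)
            rw [show ∀ p e c : ℝ, p * e * (h * c) = p * h * (e * c) by intros; ring, ← h1,
              Finset.mul_sum]
            refine Finset.sum_congr rfl fun e _ => ?_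
            have h2 : ((((filRev M.f (List.ofFn e) ω').2, a') ::
                (filRev M.f (List.ofFn e) ω').1, s) = ((s', a') :: acc, s)) ↔
                filRev M.f (List.ofFn e) ω' = (acc, s') := by
              simp [Prod.ext_iff, and_comm]
            simp only [h2]
            split_ifs
            · simp only [obsE]
              ring
            · simp
          · intro a _ hne
            simp [hne]
          · simp
        · simp [env, hs]
    rw [sum_fin_cons]
    simp only [Fintype.sum_prod_type, Fintype.sum_bool, Finset.sum_add_distrib,
      List.ofFn_cons, filRev, arriveE, if_true, Bool.false_eq_true, if_false]
    have hobs : ∀ (y : Ω × A × Bool) (e : List (Ω × A × Bool)),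
        M.obsE (y :: e) ω = ((M.f y.1, y.2.1) :: (M.obsE e y.1).1, M.f ω) := fun _ _ => rfl
    simp only [hobs]
    rw [active, frozen]
    obtain ⟨_ | ⟨⟨s', a'⟩, acc⟩, s⟩ := η
    · simp [ctrl]
    · simp only [ctrl]
      ring

theorem jointFil_eq (M : POMDP Ω A S) (h : ℝ) (σ : Strategy S A) (η : Hist S A) (ω : Ω) (a : A) :
    jointFil M h σ (η.1.length + 1) η ω a = env M η.1 η.2 ω * ctrlAct h σ η a := by
  rw [jointFil, ctrlAct, ← tsum_mul_left]
  refine tsum_congr fun n => ?_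
  rw [sum_fin_rev, sum_fin_cons]
  simp only [filHist_rev, ofFn_comp_rev, eP, List.reverse_reverse, List.ofFn_cons,
    List.countP_reverse, Fin.rev_last, Fin.cons_zero, Fintype.sum_prod_type, Fintype.sum_bool,
    Bool.false_eq_true, false_and, if_false, Finset.sum_const_zero, add_zero, true_and,
    etrajP_cons, if_true]
  rw [mul_left_comm, ← sum_arriveE, Finset.mul_sum, Finset.sum_eq_single ω]
  · rw [Finset.sum_eq_single a]
    · refine Finset.sum_congr rfl fun e _ => ?_
      by_cases he : filRev M.f (List.ofFn e) ω = η
      · have hl := length_filRev M.f (List.ofFn e) ω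
        rw [he] at hl
        rw [if_pos he, if_pos ⟨by simp [hl], he, rfl, rfl⟩]
        ring
      · simp [he]
    · intro b _ hne
      simp [hne]
    · simp
  · intro b _ hne
    simp [hne]
  · simp

/-- Probability that the strategy plays the actions of a history. -/
def playProb (σ : Strategy S A) : List (S × A) → ℝ
  | [] => 1
  | (s', a') :: l => σ (l, s') a' * playProb σ l

theorem jointBase_eq (M : POMDP Ω A S) (σ : Strategy S A) (η : Hist S A) (ω : Ω) (a : A) :
    jointBase M σ η.1.length η ω a = env M η.1 η.2 ω * playProb σ η.1 * σ η a := by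
  rw [jointBase, sum_fin_cons, ← sum_arrive M σ (fun l _ => playProb σ l) (fun _ => rfl)
    (fun _ _ _ _ => rfl), Finset.sum_mul]
  simp only [List.ofFn_cons, Fin.cons_zero, List.tail_cons, Fintype.sum_prod_type]
  rw [Finset.sum_eq_single ω]
  · rw [Finset.sum_eq_single a]
    · refine Finset.sum_congr rfl fun e _ => ?_
      by_cases he : M.obs (List.ofFn e) ω = η
      · simp [he, trajP_cons]
      · simp [he]
    · intro b _ hne
      simp [hne]
    · simp
  · intro b _ hne
    simp [hne]
  · simp

theorem mimic_mul_ctrlHist {M : POMDP Ω A S} (hM : M.IsValid) {h : ℝ}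
    (hh : h ∈ Set.Ioo (0 : ℝ) 1) {σ : Strategy S A} (hσ : IsStrategy σ) (ρ : A → ℝ)
    (η : Hist S A) {ω : Ω} (hω : env M η.1 η.2 ω ≠ 0) (a : A) :
    mimic M h σ ρ η a * ctrlHist h σ η = ctrlAct h σ η a := by
  have hA : ∀ b, jointFilA M h σ (η.1.length + 1) η b
      = (∑ ω, env M η.1 η.2 ω) * ctrlAct h σ η b := fun b => by
    rw [jointFilA, Finset.sum_mul]
    exact Finset.sum_congr rfl fun ω _ => jointFil_eq M h σ η ω b
  have hp : probFil M h σ (η.1.length + 1) η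
      = (∑ ω, env M η.1 η.2 ω) * ctrlHist h σ η := by
    simp only [probFil, hA, ← Finset.mul_sum, sum_ctrlAct hh hσ]
  have henv : (∑ ω, env M η.1 η.2 ω) ≠ 0 := fun h0 =>
    hω ((Finset.sum_eq_zero_iff_of_nonneg fun ω _ => env_nonneg hM _ _ ω).1 h0 ω
      (Finset.mem_univ ω))
  rw [mimic, hA, hp]
  by_cases hc : ctrlHist h σ η = 0
  · have h0 := sum_ctrlAct hh hσ η
    rw [hc, Finset.sum_eq_zero_iff_of_nonneg fun b _ => ctrlAct_nonneg hh hσ η b] at h0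
    rw [hc, mul_zero, h0 a (Finset.mem_univ a)]
  · rw [if_neg (mul_ne_zero henv hc)]
    field_simp

theorem playProb_mimic {M : POMDP Ω A S} (hM : M.IsValid) {h : ℝ}
    (hh : h ∈ Set.Ioo (0 : ℝ) 1) {σ : Strategy S A} (hσ : IsStrategy σ) (ρ : A → ℝ)
    (l : List (S × A)) : ∀ (s : S) (ω : Ω), env M l s ω ≠ 0 →
      playProb (mimic M h σ ρ) l = ctrlHist h σ (l, s) := by
  induction l with
  | nil => exact fun s _ _ => (summable_ctrl_nil hh hσ s).2.symm
  | cons p l ih =>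
    obtain ⟨s', a'⟩ := p
    intro s ω hω
    rw [env] at hω
    obtain ⟨ω', -, hω'⟩ := Finset.exists_ne_zero_of_sum_ne_zero (ite_ne_right_iff.1 hω).2
    have hl := right_ne_zero_of_mul hω'
    rw [playProb, ih s' ω' hl, mimic_mul_ctrlHist hM hh hσ ρ (l, s') hl,
      (summable_ctrl_cons hh hσ s' a' l s (summable_ctrl hh hσ l s')).2]

end POMDP

open POMDP in
/-- For the mimicking strategy `σ̂` of `σ`, every `k ≥ 1`, every
history `η` of length `k`, every state `ω` and action `a`, the joint laws agree:
`P^1_{σ̂}(history of the first k stages = η, ω_k = ω, a_k = a)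
  = P^h_σ(H^fil_k = η, ω'_{T_k} = ω, a'_{T_k} = a)`. -/
theorem mimic_joint_law {Ω A S : Type*} [Fintype Ω] [Fintype A]
    [DecidableEq Ω] [DecidableEq A] [DecidableEq S]
    (M : POMDP Ω A S) (hM : M.IsValid) (h : ℝ) (hh : h ∈ Set.Ioo (0 : ℝ) 1)
    (σ : Strategy S A) (hσ : IsStrategy σ)
    (ρ : A → ℝ) (hρ : (∀ a, 0 ≤ ρ a) ∧ ∑ a, ρ a = 1)
    (k : ℕ) (hk : 1 ≤ k) (η : Hist S A) (hη : η.1.length + 1 = k) (ω : Ω) (a : A) :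
    jointBase M (mimic M h σ ρ) (k - 1) η ω a = jointFil M h σ k η ω a := by
  subst hη
  rw [Nat.add_sub_cancel, jointBase_eq, jointFil_eq, mul_assoc]
  by_cases hω : env M η.1 η.2 ω = 0
  · rw [hω, zero_mul, zero_mul]
  · rw [playProb_mimic hM hh hσ ρ η.1 η.2 ω hω, mul_comm (ctrlHist h σ _),
      mimic_mul_ctrlHist hM hh hσ ρ η hω]
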